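/- Let β ∈ Φ⁺ be a positive root. The map γ ↦ −t_β(γ) maps the inversion set inv_Φ(t_β) into itself, is an involution on inv_Φ(t_β), and has β as its unique fixed point. -/

import Mathlib

/-!
Setup: a symmetrizable crystallographic Cartan matrix `A` with symmetrizers `d`,
the vector space `V = Fin n → ℝ` with standard basis `α i = Pi.single i 1`,
the bilinear form `(α i, α j) = d i * A i j`, the simple reflections
`s i (x) = x - (dᵢ⁻¹ αᵢ, x) αᵢ`, the group `W` generated by them (elements of
which are represented as products of lists of simple reflections), and the
set of real roots `Φ = { w (α i) }`.
-/

open Finset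

noncomputable section

/-- The simple root `α i`, i.e. the `i`-th standard basis vector of `ℝⁿ`. -/
def sroot (n : ℕ) (i : Fin n) : Fin n → ℝ := Pi.single i 1

/-- The symmetric bilinear form with `(α i, α j) = d i * A i j`. -/
def formL (n : ℕ) (d : Fin n → ℤ) (A : Fin n → Fin n → ℤ) :
    (Fin n → ℝ) →ₗ[ℝ] (Fin n → ℝ) →ₗ[ℝ] ℝ :=
  ∑ i : Fin n, ∑ j : Fin n,
    ((d i * A i j : ℤ) : ℝ) •
      LinearMap.smulRight (LinearMap.proj i : (Fin n → ℝ) →ₗ[ℝ] ℝ)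
        (LinearMap.proj j : (Fin n → ℝ) →ₗ[ℝ] ℝ)

/-- The simple reflection `s i`, given by `s i x = x - (dᵢ⁻¹ • αᵢ, x) • αᵢ`. -/
def simpleRefl (n : ℕ) (d : Fin n → ℤ) (A : Fin n → Fin n → ℤ) (i : Fin n) :
    Module.End ℝ (Fin n → ℝ) :=
  LinearMap.id - ((d i : ℝ)⁻¹) • (formL n d A (sroot n i)).smulRight (sroot n i)

/-- The element `s i_r * ⋯ * s i_1` of `W` corresponding to the list `l = [i_1, …, i_r]`
(the reflection `s i_1` is applied first). -/
def wprod (n : ℕ) (d : Fin n → ℤ) (A : Fin n → Fin n → ℤ) (l : List (Fin n)) :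
    Module.End ℝ (Fin n → ℝ) :=
  ((l.map (simpleRefl n d A)).reverse).prod

/-- `β` is a real root: `β = w (α i)` for some `w ∈ W` and some `i`. -/
def IsRoot (n : ℕ) (d : Fin n → ℤ) (A : Fin n → Fin n → ℤ) (β : Fin n → ℝ) : Prop :=
  ∃ (l : List (Fin n)) (i : Fin n), β = wprod n d A l (sroot n i)

/-- `β` is a positive root: a real root all of whose coordinates are `≥ 0`. -/
def IsPosRoot (n : ℕ) (d : Fin n → ℤ) (A : Fin n → Fin n → ℤ) (β : Fin n → ℝ) : Prop :=
  IsRoot n d A β ∧ ∀ k, 0 ≤ β k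

/-- `β` is a negative root: a real root all of whose coordinates are `≤ 0`. -/
def IsNegRoot (n : ℕ) (d : Fin n → ℤ) (A : Fin n → Fin n → ℤ) (β : Fin n → ℝ) : Prop :=
  IsRoot n d A β ∧ ∀ k, β k ≤ 0

/-- The reflection `t_β` along a root `β`: `t_β x = x - (β^∨, x) • β` where
`β^∨ = d_β⁻¹ • β` and `d_β = (β, β)/2`. -/
def reflAlong (n : ℕ) (d : Fin n → ℤ) (A : Fin n → Fin n → ℤ) (β : Fin n → ℝ) :
    Module.End ℝ (Fin n → ℝ) :=
  LinearMap.id - (2 / formL n d A β β) • (formL n d A β).smulRight β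

/-- The inversion set `inv_Φ(t_β)` of the reflection along a positive root `β`:
positive roots sent to negative roots by `t_β`. -/
def invSet (n : ℕ) (d : Fin n → ℤ) (A : Fin n → Fin n → ℤ) (β : Fin n → ℝ) :
    Set (Fin n → ℝ) :=
  {γ | IsPosRoot n d A γ ∧ IsNegRoot n d A (reflAlong n d A β γ)}

section helpers

variable {n : ℕ} {d : Fin n → ℤ} {A : Fin n → Fin n → ℤ}

lemma formL_eq (x y : Fin n → ℝ) :
    formL n d A x y = ∑ i, ∑ j, ((d i * A i j : ℤ) : ℝ) * (x i * y j) := by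
  simp [formL, LinearMap.sum_apply]

lemma formL_symm (hsym : ∀ i j, d i * A i j = d j * A j i) (x y : Fin n → ℝ) :
    formL n d A x y = formL n d A y x := by
  rw [formL_eq, formL_eq, Finset.sum_comm]
  refine Finset.sum_congr rfl fun i _ => Finset.sum_congr rfl fun j _ => ?_
  rw [hsym j i]; ring

lemma formL_sroot (i : Fin n) (y : Fin n → ℝ) :
    formL n d A (sroot n i) y = d i * ∑ j, (A i j : ℝ) * y j := by
  rw [formL_eq, Finset.sum_eq_single i]
  · rw [Finset.mul_sum]
    refine Finset.sum_congr rfl fun j _ => ?_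
    simp [sroot]; ring
  · intro b _ hb
    simp [sroot, hb]
  · simp

lemma formL_sroot_self (hdiag : ∀ i, A i i = 2) (i : Fin n) :
    formL n d A (sroot n i) (sroot n i) = 2 * d i := by
  rw [formL_sroot, Finset.sum_eq_single i]
  · simp [sroot, hdiag]; ring
  · intro b _ hb
    simp [sroot, hb]
  · simp

lemma simpleRefl_eq (i : Fin n) (x : Fin n → ℝ) :
    simpleRefl n d A i x = x - ((d i : ℝ)⁻¹ * formL n d A (sroot n i) x) • sroot n i := by
  simp [simpleRefl, smul_smul]

lemma reflAlong_eq (b x : Fin n → ℝ) :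
    reflAlong n d A b x = x - (2 / formL n d A b b * formL n d A b x) • b := by
  simp [reflAlong, smul_smul]

lemma simpleRefl_int (hd : ∀ i, 0 < d i) (i : Fin n) (x : Fin n → ℝ)
    (hx : ∀ k, ∃ z : ℤ, x k = z) (k : Fin n) : ∃ z : ℤ, simpleRefl n d A i x k = z := by
  choose f hf using hx
  have h0 : (d i : ℝ) ≠ 0 := by exact_mod_cast (hd i).ne'
  refine ⟨f k - (∑ j, A i j * f j) * (if k = i then 1 else 0), ?_⟩
  rw [simpleRefl_eq, formL_sroot, inv_mul_cancel_left₀ h0]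
  simp [sroot, hf, Pi.single_apply]

lemma simpleRefl_sroot (hd : ∀ i, 0 < d i) (hdiag : ∀ i, A i i = 2) (i : Fin n) :
    simpleRefl n d A i (sroot n i) = - sroot n i := by
  have h0 : (d i : ℝ) ≠ 0 := by exact_mod_cast (hd i).ne'
  rw [simpleRefl_eq, formL_sroot_self hdiag,
    show (d i : ℝ)⁻¹ * (2 * d i) = 2 by field_simp, two_smul]
  abel

lemma simpleRefl_invol (hd : ∀ i, 0 < d i) (hdiag : ∀ i, A i i = 2) (i : Fin n)
    (x : Fin n → ℝ) : simpleRefl n d A i (simpleRefl n d A i x) = x := by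
  conv_lhs => rw [simpleRefl_eq i x]
  rw [map_sub, map_smul, simpleRefl_sroot hd hdiag, simpleRefl_eq]
  simp

lemma formL_simpleRefl (hd : ∀ i, 0 < d i) (hdiag : ∀ i, A i i = 2)
    (hsym : ∀ i j, d i * A i j = d j * A j i) (i : Fin n) (x y : Fin n → ℝ) :
    formL n d A (simpleRefl n d A i x) (simpleRefl n d A i y) = formL n d A x y := by
  have h0 : (d i : ℝ) ≠ 0 := by exact_mod_cast (hd i).ne'
  simp only [simpleRefl_eq, map_sub, map_smul, LinearMap.sub_apply, LinearMap.smul_apply,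
    smul_eq_mul, formL_sroot_self hdiag, formL_symm hsym x (sroot n i)]
  field_simp
  ring

lemma wprod_nil : wprod n d A [] = 1 := by simp [wprod]

lemma wprod_cons (i : Fin n) (l : List (Fin n)) (x : Fin n → ℝ) :
    wprod n d A (i :: l) x = wprod n d A l (simpleRefl n d A i x) := by
  simp [wprod, Module.End.mul_apply]

lemma wprod_append (l m : List (Fin n)) (x : Fin n → ℝ) :
    wprod n d A (l ++ m) x = wprod n d A m (wprod n d A l x) := by
  simp [wprod, Module.End.mul_apply]

lemma wprod_reverse (hd : ∀ i, 0 < d i) (hdiag : ∀ i, A i i = 2) (l : List (Fin n)) :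
    ∀ x : Fin n → ℝ, wprod n d A l.reverse (wprod n d A l x) = x := by
  induction l with
  | nil => intro x; simp [wprod_nil]
  | cons i l ih =>
    intro x
    rw [List.reverse_cons, wprod_append, wprod_cons, wprod_cons, ih, wprod_nil,
      simpleRefl_invol hd hdiag]
    rfl

lemma formL_wprod (hd : ∀ i, 0 < d i) (hdiag : ∀ i, A i i = 2)
    (hsym : ∀ i j, d i * A i j = d j * A j i) (l : List (Fin n)) :
    ∀ x y : Fin n → ℝ, formL n d A (wprod n d A l x) (wprod n d A l y) = formL n d A x y := by
  induction l with
  | nil => intro x y; simp [wprod_nil]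
  | cons i l ih => intro x y; rw [wprod_cons, wprod_cons, ih, formL_simpleRefl hd hdiag hsym]

lemma wprod_int (hd : ∀ i, 0 < d i) (l : List (Fin n)) :
    ∀ x : Fin n → ℝ, (∀ k, ∃ z : ℤ, x k = z) → ∀ k, ∃ z : ℤ, wprod n d A l x k = z := by
  induction l with
  | nil => intro x hx; simpa [wprod_nil] using hx
  | cons i l ih => intro x hx; rw [wprod_cons]; exact ih _ (simpleRefl_int hd i x hx)

lemma sroot_int (i k : Fin n) : ∃ z : ℤ, sroot n i k = z :=
  ⟨if k = i then 1 else 0, by simp [sroot, Pi.single_apply]⟩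

lemma IsRoot.neg (hd : ∀ i, 0 < d i) (hdiag : ∀ i, A i i = 2) {b : Fin n → ℝ}
    (hb : IsRoot n d A b) : IsRoot n d A (-b) := by
  obtain ⟨l, i, rfl⟩ := hb
  exact ⟨i :: l, i, by rw [wprod_cons, simpleRefl_sroot hd hdiag, map_neg]⟩

lemma IsRoot.form_pos (hd : ∀ i, 0 < d i) (hdiag : ∀ i, A i i = 2)
    (hsym : ∀ i j, d i * A i j = d j * A j i) {b : Fin n → ℝ}
    (hb : IsRoot n d A b) : 0 < formL n d A b b := by
  obtain ⟨l, i, rfl⟩ := hb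
  rw [formL_wprod hd hdiag hsym, formL_sroot_self hdiag]
  have : (0 : ℝ) < d i := by exact_mod_cast hd i
  positivity

lemma IsRoot.smul_int (hd : ∀ i, 0 < d i) (hdiag : ∀ i, A i i = 2) {b : Fin n → ℝ} {c : ℝ}
    (hb : IsRoot n d A b) (hc : IsRoot n d A (c • b)) : ∃ z : ℤ, c = z := by
  obtain ⟨l, i, rfl⟩ := hb
  obtain ⟨m, j, h⟩ := hc
  have h2 := congrArg (wprod n d A l.reverse) h
  rw [map_smul, wprod_reverse hd hdiag] at h2
  obtain ⟨z, hz⟩ := wprod_int (A := A) hd l.reverse _ (wprod_int (A := A) hd m _ (sroot_int j)) i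
  refine ⟨z, ?_⟩
  rw [← hz, ← h2]
  simp [sroot]

lemma reflAlong_self {b : Fin n → ℝ} (hb : 0 < formL n d A b b) :
    reflAlong n d A b b = -b := by
  rw [reflAlong_eq, div_mul_cancel₀ _ hb.ne', two_smul]
  abel

lemma reflAlong_invol {b : Fin n → ℝ} (hb : 0 < formL n d A b b) (x : Fin n → ℝ) :
    reflAlong n d A b (reflAlong n d A b x) = x := by
  conv_lhs => rw [reflAlong_eq b x]
  rw [map_sub, map_smul, reflAlong_self hb, reflAlong_eq]
  simp

end helpers

/-- `γ ↦ -t_β γ` maps `inv_Φ(t_β)` into itself, is an involution on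
it, and has `β` as its unique fixed point. -/
theorem stmt4 (n : ℕ) (hn : 1 ≤ n) (d : Fin n → ℤ) (A : Fin n → Fin n → ℤ)
    (hd : ∀ i, 0 < d i) (hdiag : ∀ i, A i i = 2)
    (hoff : ∀ i j, i ≠ j → A i j ≤ 0)
    (hsym : ∀ i j, d i * A i j = d j * A j i)
    (β : Fin n → ℝ) (hβ : IsPosRoot n d A β) :
    (∀ γ ∈ invSet n d A β, -(reflAlong n d A β γ) ∈ invSet n d A β)
    ∧ (∀ γ ∈ invSet n d A β, -(reflAlong n d A β (-(reflAlong n d A β γ))) = γ)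
    ∧ β ∈ invSet n d A β
    ∧ (∀ γ ∈ invSet n d A β, (-(reflAlong n d A β γ) = γ ↔ γ = β)) := by
  have hp := hβ.1.form_pos hd hdiag hsym
  refine ⟨?_, ?_, ?_, ?_⟩
  · rintro γ ⟨h1, h2⟩
    refine ⟨⟨h2.1.neg hd hdiag, fun k => by simpa using h2.2 k⟩, ?_⟩
    rw [map_neg, reflAlong_invol hp]
    exact ⟨h1.1.neg hd hdiag, fun k => by simpa using h1.2 k⟩
  · intro γ _
    rw [map_neg, reflAlong_invol hp, neg_neg]
  · refine ⟨hβ, ?_⟩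
    rw [reflAlong_self hp]
    exact ⟨hβ.1.neg hd hdiag, fun k => by simpa using hβ.2 k⟩
  · rintro γ ⟨h1, -⟩
    constructor
    · intro h
      obtain ⟨c, rfl⟩ : ∃ c : ℝ, γ = c • β := by
        refine ⟨(2 / formL n d A β β * formL n d A β γ) / 2, ?_⟩
        rw [reflAlong_eq] at h
        ext k
        have := congrFun h k
        simp only [Pi.neg_apply, Pi.sub_apply, Pi.smul_apply, smul_eq_mul] at this ⊢
        linarith
      have hpc := h1.1.form_pos hd hdiag hsym
      have hc0 : c ≠ 0 := by
        rintro rfl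
        simp at hpc
      obtain ⟨z, hz⟩ := hβ.1.smul_int hd hdiag h1.1
      obtain ⟨w, hw⟩ := h1.1.smul_int (c := c⁻¹) hd hdiag (by
        rw [smul_smul, inv_mul_cancel₀ hc0, one_smul]; exact hβ.1)
      have hzw : z * w = 1 := by
        have : (z : ℝ) * w = 1 := by rw [← hz, ← hw, mul_inv_cancel₀ hc0]
        exact_mod_cast this
      rcases Int.eq_one_or_neg_one_of_mul_eq_one hzw with h' | h'
      · rw [hz, h']; simp
      · exfalso
        rw [h'] at hz
        have hβ0 : β = 0 := by
          ext k
          have h3 := h1.2 k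
          have h4 := hβ.2 k
          rw [hz] at h3
          simp at h3
          exact le_antisymm h3 h4
        rw [hβ0] at hp
        simp at hp
    · rintro rfl
      rw [reflAlong_self hp, neg_neg]

end
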